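/- Let 1/2 < s ≤ 1 and 0 < σ < 2s − 1. Then there exists a constant C > 0 such that for all Schwartz functions u, v on ℝ², ‖uv‖_{H^{s−1}} ≤ C ‖u‖_{H^s} ‖v‖_{Ḣ^σ}. -/

import Mathlib

open MeasureTheory Real
open scoped FourierTransform

noncomputable section

abbrev Plane := EuclideanSpace ℝ (Fin 2)

/-- The inhomogeneous Sobolev norm `‖f‖_{H^s} = (∫ (1+|ξ|²)^s |f̂(ξ)|² dξ)^{1/2}` on ℝ². -/
def sobNorm (s : ℝ) (f : Plane → ℂ) : ℝ :=
  (∫ ξ : Plane, (1 + ‖ξ‖ ^ 2) ^ s * ‖𝓕 f ξ‖ ^ 2) ^ (1/2 : ℝ)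

/-- The homogeneous Sobolev norm `‖f‖_{Ḣ^s} = (∫ |ξ|^{2s} |f̂(ξ)|² dξ)^{1/2}` on ℝ². -/
def homNorm (s : ℝ) (f : Plane → ℂ) : ℝ :=
  (∫ ξ : Plane, ‖ξ‖ ^ (2 * s) * ‖𝓕 f ξ‖ ^ 2) ^ (1/2 : ℝ)

open scoped ENNReal

theorem lintegral_mul_sq_le {α : Type*} [MeasurableSpace α] {μ : Measure α} {f g : α → ℝ≥0∞}
    (hf : AEMeasurable f μ) (hg : AEMeasurable g μ) :
    (∫⁻ x, f x * g x ∂μ) ^ 2 ≤ (∫⁻ x, f x ^ 2 ∂μ) * ∫⁻ x, g x ^ 2 ∂μ := by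
  have h := ENNReal.lintegral_mul_le_Lp_mul_Lq μ Real.HolderConjugate.two_two hf hg
  simp only [Pi.mul_apply, ENNReal.rpow_two] at h
  calc (∫⁻ x, f x * g x ∂μ) ^ 2
      ≤ ((∫⁻ x, f x ^ 2 ∂μ) ^ (1 / 2 : ℝ) * (∫⁻ x, g x ^ 2 ∂μ) ^ (1 / 2 : ℝ)) ^ 2 := by gcongr
    _ = _ := by
      rw [mul_pow, ← ENNReal.rpow_two, ← ENNReal.rpow_two, ← ENNReal.rpow_mul, ← ENNReal.rpow_mul]
      norm_num

theorem lintegral_sq_kernel_le_of_row {k : Plane → Plane → ℝ≥0∞} {f g : Plane → ℝ≥0∞} {A : ℝ≥0∞}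
    (hk : Measurable (Function.uncurry k)) (hf : Measurable f) (hg : Measurable g)
    (hA : ∀ᵐ ξ, ∫⁻ η, k ξ η ^ 2 ≤ A) :
    ∫⁻ ξ, (∫⁻ η, k ξ η * (f (ξ - η) * g η)) ^ 2 ≤ A * ((∫⁻ x, f x ^ 2) * ∫⁻ x, g x ^ 2) := by
  calc ∫⁻ ξ, (∫⁻ η, k ξ η * (f (ξ - η) * g η)) ^ 2
      ≤ ∫⁻ ξ, A * ∫⁻ η, (f (ξ - η) * g η) ^ 2 := by
        refine lintegral_mono_ae ?_
        filter_upwards [hA] with ξ hξ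
        refine (lintegral_mul_sq_le (hk.of_uncurry_left).aemeasurable (by fun_prop)).trans ?_
        gcongr
    _ = A * ∫⁻ η, ∫⁻ ξ, (f (ξ - η) * g η) ^ 2 := by
        rw [lintegral_const_mul, lintegral_lintegral_swap]
        · exact Measurable.aemeasurable (by unfold Function.uncurry; fun_prop)
        · exact Measurable.lintegral_prod_right' (f := fun p : Plane × Plane ↦
            (f (p.1 - p.2) * g p.2) ^ 2) (by fun_prop)
    _ = A * ((∫⁻ x, f x ^ 2) * ∫⁻ x, g x ^ 2) := by
        congr 1
        rw [← lintegral_const_mul _ (by fun_prop)]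
        refine lintegral_congr fun η ↦ ?_
        simp_rw [mul_pow]
        rw [lintegral_mul_const _ (by fun_prop),
          lintegral_sub_right_eq_self (fun x ↦ f x ^ 2) η]

theorem lintegral_sq_kernel_le_of_col {k : Plane → Plane → ℝ≥0∞} {f g : Plane → ℝ≥0∞} {B : ℝ≥0∞}
    (hk : Measurable (Function.uncurry k)) (hf : Measurable f) (hg : Measurable g)
    (hB : ∀ᵐ η, ∫⁻ ξ, k ξ η ^ 2 ≤ B) :
    ∫⁻ ξ, (∫⁻ η, k ξ η * (f (ξ - η) * g η)) ^ 2 ≤ B * ((∫⁻ x, f x ^ 2) * ∫⁻ x, g x ^ 2) := by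
  have hk2 : Measurable fun p : Plane × Plane ↦ (k p.1 p.2 * g p.2) ^ 2 := by
    have : Measurable fun p : Plane × Plane ↦ k p.1 p.2 := hk
    fun_prop
  calc ∫⁻ ξ, (∫⁻ η, k ξ η * (f (ξ - η) * g η)) ^ 2
      ≤ ∫⁻ ξ, (∫⁻ x, f x ^ 2) * ∫⁻ η, (k ξ η * g η) ^ 2 := by
        refine lintegral_mono fun ξ ↦ ?_
        simp_rw [mul_left_comm (k _ _)]
        have hkξ : Measurable (k ξ) := hk.of_uncurry_left
        refine (lintegral_mul_sq_le (by fun_prop) (by fun_prop)).trans ?_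
        rw [lintegral_sub_left_eq_self (fun x ↦ f x ^ 2) ξ]
    _ = (∫⁻ x, f x ^ 2) * ∫⁻ η, ∫⁻ ξ, (k ξ η * g η) ^ 2 := by
        rw [lintegral_const_mul, lintegral_lintegral_swap]
        · exact hk2.aemeasurable
        · exact hk2.lintegral_prod_right'
    _ ≤ (∫⁻ x, f x ^ 2) * ∫⁻ η, B * g η ^ 2 := by
        gcongr (∫⁻ x, f x ^ 2) * ?_
        refine lintegral_mono_ae ?_
        filter_upwards [hB] with η hη
        have hkη : Measurable fun ξ ↦ k ξ η := hk.of_uncurry_right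
        simp_rw [mul_pow]
        rw [lintegral_mul_const _ (by fun_prop)]
        gcongr
    _ = _ := by
        rw [lintegral_const_mul _ (by fun_prop)]
        ring

/-- The integral of `‖x‖ ^ (-2α)` over the closed ball of radius `R` in the plane. -/
def ballRieszIntegral (α : ℝ) (R : ℝ≥0∞) : ℝ≥0∞ :=
  ∫⁻ x : Plane, if ‖x‖ₑ ≤ R then ‖x‖ₑ ^ (-(2 * α)) else 0

theorem ballRieszIntegral_one_ne_top {α : ℝ} (hα : α < 1) : ballRieszIntegral α 1 ≠ ∞ := by
  have h : IntegrableOn (fun x : Plane ↦ ‖x‖ ^ (-(2 * α))) (Metric.ball 0 2) := by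
    refine integrableOn_ball_of_norm_le_rpow (C := 1) (α := 2 * α) (by simp) ?_ ?_ ?_
    · simp; linarith
    · refine Filter.Eventually.of_forall fun x ↦ ?_
      rw [one_mul, Real.norm_of_nonneg (by positivity)]
    · exact Measurable.aestronglyMeasurable (by fun_prop)
  have h2 := h.2
  rw [hasFiniteIntegral_iff_enorm] at h2
  refine ne_top_of_le_ne_top h2.ne ?_
  rw [ballRieszIntegral, ← lintegral_indicator measurableSet_ball]
  refine lintegral_mono_ae ?_
  filter_upwards [Measure.ae_ne volume (0 : Plane)] with x hx
  split_ifs with hx1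
  · have hx2 : ‖x‖ ≤ 1 := by
      rw [← ofReal_norm] at hx1
      rwa [← ENNReal.ofReal_one, ENNReal.ofReal_le_ofReal_iff zero_le_one] at hx1
    rw [Set.indicator_of_mem (by simp; linarith), Real.enorm_of_nonneg (by positivity),
      ← ENNReal.ofReal_rpow_of_pos (by simpa using hx), ofReal_norm]
  · exact zero_le

theorem ballRieszIntegral_eq (α : ℝ) {R : ℝ≥0∞} (h0 : R ≠ 0) (hR : R ≠ ∞) :
    ballRieszIntegral α R = R ^ (2 - 2 * α) * ballRieszIntegral α 1 := by
  have hr : 0 < R.toReal := ENNReal.toReal_pos h0 hR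
  have hsmul (x : Plane) : ‖R.toReal • x‖ₑ = R * ‖x‖ₑ := by
    rw [enorm_smul, Real.enorm_of_nonneg hr.le, ENNReal.ofReal_toReal hR]
  have hmap := Measure.map_addHaar_smul (volume : Measure Plane) hr.ne'
  have hmeas : Measurable fun x : Plane ↦ if ‖x‖ₑ ≤ R then ‖x‖ₑ ^ (-(2 * α)) else 0 :=
    Measurable.ite (measurableSet_le (by fun_prop) (by fun_prop)) (by fun_prop) (by fun_prop)
  have hmeas1 : Measurable fun x : Plane ↦ if ‖x‖ₑ ≤ 1 then ‖x‖ₑ ^ (-(2 * α)) else 0 :=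
    Measurable.ite (measurableSet_le (by fun_prop) (by fun_prop)) (by fun_prop) (by fun_prop)
  have h1 := lintegral_map (μ := (volume : Measure Plane)) hmeas
    (measurable_const_smul R.toReal)
  rw [hmap, lintegral_smul_measure] at h1
  have h2 (x : Plane) : (if ‖R.toReal • x‖ₑ ≤ R then ‖R.toReal • x‖ₑ ^ (-(2 * α)) else 0) =
      R ^ (-(2 * α)) * if ‖x‖ₑ ≤ 1 then ‖x‖ₑ ^ (-(2 * α)) else 0 := by
    rw [hsmul, mul_ite, mul_zero, ENNReal.mul_rpow_of_ne_top hR enorm_ne_top]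
    refine if_congr ?_ rfl rfl
    nth_rewrite 2 [← mul_one R]
    exact ENNReal.mul_le_mul_iff_right h0 hR
  simp_rw [h2] at h1
  rw [lintegral_const_mul _ hmeas1] at h1
  have hcoef : ENNReal.ofReal |(R.toReal ^ Module.finrank ℝ Plane)⁻¹| = R ^ (-2 : ℝ) := by
    rw [abs_of_pos (by positivity), ENNReal.ofReal_inv_of_pos (by positivity),
      ENNReal.ofReal_pow hr.le, ENNReal.ofReal_toReal hR, ENNReal.rpow_neg]
    simp
  rw [hcoef, smul_eq_mul] at h1
  change R ^ (-2 : ℝ) * ballRieszIntegral α R = R ^ (-(2 * α)) * ballRieszIntegral α 1 at h1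
  calc ballRieszIntegral α R
      = R ^ (2 : ℝ) * (R ^ (-2 : ℝ) * ballRieszIntegral α R) := by
        rw [← mul_assoc, ← ENNReal.rpow_add _ _ h0 hR]; simp
    _ = _ := by
        rw [h1, ← mul_assoc, ← ENNReal.rpow_add _ _ h0 hR]; ring_nf

/-- The homogeneous kernel with weights `‖ξ‖ ^ (-a)`, `‖ξ - η‖ ^ (-t)` and `‖η‖ ^ (-σ)`. -/
def rieszKernel (a t σ : ℝ) (ξ η : Plane) : ℝ≥0∞ :=
  ‖ξ‖ₑ ^ (-a) * (‖ξ - η‖ₑ ^ (-t) * ‖η‖ₑ ^ (-σ))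

theorem measurable_rieszKernel (a t σ : ℝ) : Measurable (Function.uncurry (rieszKernel a t σ)) := by
  unfold Function.uncurry rieszKernel
  fun_prop

theorem rieszKernel_sq (a t σ : ℝ) (ξ η : Plane) :
    rieszKernel a t σ ξ η ^ 2 =
      ‖ξ‖ₑ ^ (-(2 * a)) * (‖ξ - η‖ₑ ^ (-(2 * t)) * ‖η‖ₑ ^ (-(2 * σ))) := by
  have h (x : ℝ≥0∞) (r : ℝ) : (x ^ (-r)) ^ 2 = x ^ (-(2 * r)) := by
    rw [← ENNReal.rpow_two, ← ENNReal.rpow_mul]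
    ring_nf
  rw [rieszKernel, mul_pow, mul_pow, h, h, h]

/-- The part of `rieszKernel` in the region `‖η‖ ≤ 2‖ξ‖`. -/
def lowKernel (a t σ : ℝ) (ξ η : Plane) : ℝ≥0∞ :=
  if ‖η‖ₑ ≤ 2 * ‖ξ‖ₑ then rieszKernel a t σ ξ η else 0

/-- The part of `rieszKernel` in the region `‖η‖ > 2‖ξ‖`. -/
def highKernel (a t σ : ℝ) (ξ η : Plane) : ℝ≥0∞ :=
  if ‖η‖ₑ ≤ 2 * ‖ξ‖ₑ then 0 else rieszKernel a t σ ξ η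

theorem measurable_lowKernel (a t σ : ℝ) : Measurable (Function.uncurry (lowKernel a t σ)) :=
  Measurable.ite (measurableSet_le (by fun_prop) (by fun_prop)) (measurable_rieszKernel a t σ)
    measurable_const

theorem measurable_highKernel (a t σ : ℝ) : Measurable (Function.uncurry (highKernel a t σ)) :=
  Measurable.ite (measurableSet_le (by fun_prop) (by fun_prop)) measurable_const
    (measurable_rieszKernel a t σ)

theorem enorm_rpow_neg_le {x : Plane} {X : ℝ≥0∞} {r : ℝ} (hr : 0 ≤ r) (h : X ≤ ‖x‖ₑ) :
    ‖x‖ₑ ^ (-r) ≤ X ^ (-r) := by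
  rw [ENNReal.rpow_neg, ENNReal.rpow_neg]
  gcongr

theorem half_mul_add_half_mul (x : ℝ≥0∞) : 2⁻¹ * x + 2⁻¹ * x = x := by
  rw [← add_mul, ENNReal.inv_two_add_inv_two, one_mul]

theorem lowKernel_sq_le {a t σ : ℝ} (ht : 0 ≤ t) (hσ : 0 ≤ σ) (ξ η : Plane) :
    lowKernel a t σ ξ η ^ 2 ≤ ‖ξ‖ₑ ^ (-(2 * a)) *
      ((2⁻¹ * ‖ξ‖ₑ) ^ (-(2 * t)) * (if ‖η‖ₑ ≤ 2 * ‖ξ‖ₑ then ‖η‖ₑ ^ (-(2 * σ)) else 0) +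
       (2⁻¹ * ‖ξ‖ₑ) ^ (-(2 * σ)) *
        (if ‖ξ - η‖ₑ ≤ 3 * ‖ξ‖ₑ then ‖ξ - η‖ₑ ^ (-(2 * t)) else 0)) := by
  unfold lowKernel
  split_ifs with h1 h2 h2
  · rw [rieszKernel_sq]
    gcongr
    by_cases h3 : 2⁻¹ * ‖ξ‖ₑ ≤ ‖ξ - η‖ₑ
    · refine le_add_right ?_
      gcongr ?_ * _
      exact enorm_rpow_neg_le (by positivity) h3
    · have h4 : 2⁻¹ * ‖ξ‖ₑ ≤ ‖η‖ₑ := by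
        by_contra h4
        have h5 : ‖ξ‖ₑ ≤ ‖ξ - η‖ₑ + ‖η‖ₑ := by simpa using enorm_add_le (ξ - η) η
        have h6 := ENNReal.add_lt_add (not_le.1 h3) (not_le.1 h4)
        rw [half_mul_add_half_mul] at h6
        exact absurd h5 (not_le.2 h6)
      refine le_add_left ?_
      rw [mul_comm]
      gcongr ?_ * _
      exact enorm_rpow_neg_le (by positivity) h4
  · refine absurd ?_ h2
    calc ‖ξ - η‖ₑ ≤ ‖ξ‖ₑ + ‖η‖ₑ := enorm_sub_le
      _ ≤ ‖ξ‖ₑ + 2 * ‖ξ‖ₑ := by gcongr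
      _ = 3 * ‖ξ‖ₑ := by ring
  · simp
  · simp

theorem highKernel_sq_le {a t σ : ℝ} (ht : 0 ≤ t) (ξ η : Plane) :
    highKernel a t σ ξ η ^ 2 ≤ ((2⁻¹ * ‖η‖ₑ) ^ (-(2 * t)) * ‖η‖ₑ ^ (-(2 * σ))) *
      (if ‖ξ‖ₑ ≤ ‖η‖ₑ then ‖ξ‖ₑ ^ (-(2 * a)) else 0) := by
  unfold highKernel
  split_ifs with h1 h2 h2
  · simp
  · simp
  · rw [rieszKernel_sq, mul_comm]
    gcongr ?_ * _ * _
    refine enorm_rpow_neg_le (by positivity) ?_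
    by_contra h3
    have h4 : ‖ξ‖ₑ ≤ 2⁻¹ * ‖η‖ₑ := by
      calc ‖ξ‖ₑ = 2⁻¹ * (2 * ‖ξ‖ₑ) := by
            rw [two_mul, mul_add, half_mul_add_half_mul]
        _ ≤ 2⁻¹ * ‖η‖ₑ := by gcongr; exact (not_le.1 h1).le
    have h5 : ‖η‖ₑ ≤ ‖ξ‖ₑ + ‖ξ - η‖ₑ := by simpa using enorm_sub_le (a := ξ) (b := ξ - η)
    have h6 := ENNReal.add_lt_add_of_le_of_lt enorm_ne_top h4 (not_le.1 h3)
    rw [half_mul_add_half_mul] at h6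
    exact absurd h5 (not_le.2 h6)
  · refine absurd ?_ h2
    refine le_trans ?_ (not_le.1 h1).le
    rw [two_mul]
    exact le_self_add

theorem lintegral_lowKernel_sq_le {a t σ : ℝ} (ht : 0 ≤ t) (hσ : 0 ≤ σ) (hsum : a + t + σ = 1)
    {ξ : Plane} (hξ : ξ ≠ 0) :
    ∫⁻ η, lowKernel a t σ ξ η ^ 2 ≤
      2⁻¹ ^ (-(2 * t)) * 2 ^ (2 - 2 * σ) * ballRieszIntegral σ 1 +
      2⁻¹ ^ (-(2 * σ)) * 3 ^ (2 - 2 * t) * ballRieszIntegral t 1 := by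
  have h0 : ‖ξ‖ₑ ≠ 0 := by simpa using hξ
  have h1 : ‖ξ‖ₑ ≠ ∞ := enorm_ne_top
  have hm (c : ℝ≥0∞) (r : ℝ) : Measurable fun x : Plane ↦ if ‖x‖ₑ ≤ c then ‖x‖ₑ ^ r else 0 :=
    Measurable.ite (measurableSet_le (by fun_prop) (by fun_prop)) (by fun_prop) (by fun_prop)
  have hm' (c : ℝ≥0∞) (r : ℝ) :
      Measurable fun x : Plane ↦ if ‖ξ - x‖ₑ ≤ c then ‖ξ - x‖ₑ ^ r else 0 :=
    (hm c r).comp (by fun_prop)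
  refine (lintegral_mono fun η ↦ lowKernel_sq_le ht hσ ξ η).trans_eq ?_
  rw [lintegral_const_mul' _ _ (ENNReal.rpow_ne_top_of_ne_zero h0 h1),
    lintegral_add_left ((hm _ _).const_mul _), lintegral_const_mul _ (hm _ _),
    lintegral_const_mul _ (hm' _ _),
    lintegral_sub_left_eq_self
      (fun x : Plane ↦ if ‖x‖ₑ ≤ 3 * ‖ξ‖ₑ then ‖x‖ₑ ^ (-(2 * t)) else 0) ξ]
  change _ * (_ * ballRieszIntegral σ _ + _ * ballRieszIntegral t _) = _
  rw [ballRieszIntegral_eq σ (by simpa using h0) (by finiteness),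
    ballRieszIntegral_eq t (by simpa using h0) (by finiteness)]
  simp_rw [ENNReal.mul_rpow_of_ne_top (show (2⁻¹ : ℝ≥0∞) ≠ ∞ by simp) h1,
    ENNReal.mul_rpow_of_ne_top (show (2 : ℝ≥0∞) ≠ ∞ by simp) h1,
    ENNReal.mul_rpow_of_ne_top (show (3 : ℝ≥0∞) ≠ ∞ by simp) h1]
  have e (p q r : ℝ) (h : p + q + r = 0) : ‖ξ‖ₑ ^ p * ‖ξ‖ₑ ^ q * ‖ξ‖ₑ ^ r = 1 := by
    rw [← ENNReal.rpow_add _ _ h0 h1, ← ENNReal.rpow_add _ _ h0 h1, h, ENNReal.rpow_zero]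
  calc _ = 2⁻¹ ^ (-(2 * t)) * 2 ^ (2 - 2 * σ) * ballRieszIntegral σ 1 *
          (‖ξ‖ₑ ^ (-(2 * a)) * ‖ξ‖ₑ ^ (-(2 * t)) * ‖ξ‖ₑ ^ (2 - 2 * σ)) +
        2⁻¹ ^ (-(2 * σ)) * 3 ^ (2 - 2 * t) * ballRieszIntegral t 1 *
          (‖ξ‖ₑ ^ (-(2 * a)) * ‖ξ‖ₑ ^ (-(2 * σ)) * ‖ξ‖ₑ ^ (2 - 2 * t)) := by ring
    _ = _ := by
      rw [e _ _ _ (by linarith), e _ _ _ (by linarith), mul_one, mul_one]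

theorem lintegral_highKernel_sq_le {a t σ : ℝ} (ht : 0 ≤ t) (hsum : a + t + σ = 1)
    {η : Plane} (hη : η ≠ 0) :
    ∫⁻ ξ, highKernel a t σ ξ η ^ 2 ≤ 2⁻¹ ^ (-(2 * t)) * ballRieszIntegral a 1 := by
  have h0 : ‖η‖ₑ ≠ 0 := by simpa using hη
  have h1 : ‖η‖ₑ ≠ ∞ := enorm_ne_top
  have hm (c : ℝ≥0∞) (r : ℝ) : Measurable fun x : Plane ↦ if ‖x‖ₑ ≤ c then ‖x‖ₑ ^ r else 0 :=
    Measurable.ite (measurableSet_le (by fun_prop) (by fun_prop)) (by fun_prop) (by fun_prop)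
  refine (lintegral_mono fun ξ ↦ highKernel_sq_le ht ξ η).trans_eq ?_
  rw [lintegral_const_mul _ (hm _ _)]
  change _ * ballRieszIntegral a _ = _
  rw [ballRieszIntegral_eq a h0 h1,
    ENNReal.mul_rpow_of_ne_top (show (2⁻¹ : ℝ≥0∞) ≠ ∞ by simp) h1]
  have e : ‖η‖ₑ ^ (-(2 * t)) * ‖η‖ₑ ^ (-(2 * σ)) * ‖η‖ₑ ^ (2 - 2 * a) = 1 := by
    rw [← ENNReal.rpow_add _ _ h0 h1, ← ENNReal.rpow_add _ _ h0 h1, ← ENNReal.rpow_zero (x := ‖η‖ₑ)]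
    congr 1
    linarith
  calc _ = 2⁻¹ ^ (-(2 * t)) * ballRieszIntegral a 1 *
        (‖η‖ₑ ^ (-(2 * t)) * ‖η‖ₑ ^ (-(2 * σ)) * ‖η‖ₑ ^ (2 - 2 * a)) := by ring
    _ = _ := by rw [e, mul_one]

theorem exists_lintegral_rieszKernel_sq_le {a t σ : ℝ} (ha : a < 1) (ht : 0 ≤ t) (ht1 : t < 1)
    (hσ : 0 ≤ σ) (hσ1 : σ < 1) (hsum : a + t + σ = 1) :
    ∃ C : ℝ≥0∞, C ≠ ∞ ∧ ∀ f g : Plane → ℝ≥0∞, Measurable f → Measurable g →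
      ∫⁻ ξ, (∫⁻ η, rieszKernel a t σ ξ η * (f (ξ - η) * g η)) ^ 2 ≤
        C * ((∫⁻ x, f x ^ 2) * ∫⁻ x, g x ^ 2) := by
  refine ⟨2 * (2⁻¹ ^ (-(2 * t)) * 2 ^ (2 - 2 * σ) * ballRieszIntegral σ 1 +
      2⁻¹ ^ (-(2 * σ)) * 3 ^ (2 - 2 * t) * ballRieszIntegral t 1) +
      2 * (2⁻¹ ^ (-(2 * t)) * ballRieszIntegral a 1), ?_, fun f g hf hg ↦ ?_⟩
  · have h1 := ballRieszIntegral_one_ne_top ha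
    have h2 := ballRieszIntegral_one_ne_top ht1
    have h3 := ballRieszIntegral_one_ne_top hσ1
    have h4 (r : ℝ) : (2⁻¹ : ℝ≥0∞) ^ r ≠ ∞ := ENNReal.rpow_ne_top_of_ne_zero (by simp) (by simp)
    have h5 (r : ℝ) : (2 : ℝ≥0∞) ^ r ≠ ∞ := ENNReal.rpow_ne_top_of_ne_zero (by simp) (by simp)
    have h6 (r : ℝ) : (3 : ℝ≥0∞) ^ r ≠ ∞ := ENNReal.rpow_ne_top_of_ne_zero (by simp) (by simp)
    have h7 := h4 (-(2 * t))
    have h8 := h4 (-(2 * σ))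
    have h9 := h5 (2 - 2 * σ)
    have h10 := h6 (2 - 2 * t)
    finiteness
  · have hlow := lintegral_sq_kernel_le_of_row (measurable_lowKernel a t σ) hf hg
      ((Measure.ae_ne volume (0 : Plane)).mono fun ξ hξ ↦ lintegral_lowKernel_sq_le ht hσ hsum hξ)
    have hhigh := lintegral_sq_kernel_le_of_col (measurable_highKernel a t σ) hf hg
      ((Measure.ae_ne volume (0 : Plane)).mono fun η hη ↦ lintegral_highKernel_sq_le ht hsum hη)
    have hmlow : Measurable fun p : Plane × Plane ↦ lowKernel a t σ p.1 p.2 :=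
      measurable_lowKernel a t σ
    have hmhigh : Measurable fun p : Plane × Plane ↦ highKernel a t σ p.1 p.2 :=
      measurable_highKernel a t σ
    have hsplit (ξ : Plane) : ∫⁻ η, rieszKernel a t σ ξ η * (f (ξ - η) * g η) =
        (∫⁻ η, lowKernel a t σ ξ η * (f (ξ - η) * g η)) +
          ∫⁻ η, highKernel a t σ ξ η * (f (ξ - η) * g η) := by
      rw [← lintegral_add_left (by fun_prop)]
      refine lintegral_congr fun η ↦ ?_
      rw [← add_mul, lowKernel, highKernel]
      split_ifs <;> simp
    have hsq (x y : ℝ≥0∞) : (x + y) ^ 2 ≤ 2 * x ^ 2 + 2 * y ^ 2 := by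
      have h := ENNReal.rpow_add_le_mul_rpow_add_rpow x y (p := 2) (by norm_num)
      norm_num at h
      rwa [mul_add] at h
    calc ∫⁻ ξ, (∫⁻ η, rieszKernel a t σ ξ η * (f (ξ - η) * g η)) ^ 2
        ≤ ∫⁻ ξ, (2 * (∫⁻ η, lowKernel a t σ ξ η * (f (ξ - η) * g η)) ^ 2 +
          2 * (∫⁻ η, highKernel a t σ ξ η * (f (ξ - η) * g η)) ^ 2) := by
          refine lintegral_mono fun ξ ↦ ?_
          rw [hsplit]
          exact hsq _ _
      _ = 2 * (∫⁻ ξ, (∫⁻ η, lowKernel a t σ ξ η * (f (ξ - η) * g η)) ^ 2) +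
          2 * ∫⁻ ξ, (∫⁻ η, highKernel a t σ ξ η * (f (ξ - η) * g η)) ^ 2 := by
          rw [lintegral_add_left, lintegral_const_mul, lintegral_const_mul]
          · exact (Measurable.lintegral_prod_right' (f := fun p : Plane × Plane ↦
              highKernel a t σ p.1 p.2 * (f (p.1 - p.2) * g p.2)) (by fun_prop)).pow_const 2
          · exact (Measurable.lintegral_prod_right' (f := fun p : Plane × Plane ↦
              lowKernel a t σ p.1 p.2 * (f (p.1 - p.2) * g p.2)) (by fun_prop)).pow_const 2
          · exact ((Measurable.lintegral_prod_right' (f := fun p : Plane × Plane ↦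
              lowKernel a t σ p.1 p.2 * (f (p.1 - p.2) * g p.2)) (by fun_prop)).pow_const
                2).const_mul 2
      _ ≤ _ := by
          rw [add_mul, mul_assoc 2, mul_assoc 2]
          gcongr

theorem fourier_mul_eq_integral (u v : SchwartzMap Plane ℂ) (ξ : Plane) :
    𝓕 (fun x ↦ u x * v x) ξ = ∫ η, 𝓕 (fun x ↦ u x) (ξ - η) * 𝓕 (fun x ↦ v x) η := by
  let W := SchwartzMap.convolution (ContinuousLinearMap.mul ℂ ℂ) (𝓕 v) (𝓕 u)
  have hW : (fun x ↦ u x * v x) = 𝓕⁻ W := by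
    ext x
    have hu : u x = 𝓕 (𝓕 u) (-x) := by
      rw [SchwartzMap.fourier_coe, ← Real.fourierInv_eq_fourier_neg, ← SchwartzMap.fourierInv_coe,
        FourierTransform.fourierInv_fourier_eq]
    have hv : v x = 𝓕 (𝓕 v) (-x) := by
      rw [SchwartzMap.fourier_coe, ← Real.fourierInv_eq_fourier_neg, ← SchwartzMap.fourierInv_coe,
        FourierTransform.fourierInv_fourier_eq]
    rw [SchwartzMap.fourierInv_coe, Real.fourierInv_eq_fourier_neg, ← SchwartzMap.fourier_coe,
      SchwartzMap.fourier_convolution, SchwartzMap.pairing_apply_apply, hu, hv]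
    simp [mul_comm]
  rw [hW, ← SchwartzMap.fourier_coe, FourierTransform.fourier_fourierInv_eq,
    SchwartzMap.convolution_apply, convolution_def]
  refine integral_congr_ae (Filter.Eventually.of_forall fun η ↦ ?_)
  simp [SchwartzMap.fourier_coe, mul_comm]

theorem integrable_one_add_norm_sq_mul_norm_sq (f : SchwartzMap Plane ℂ) :
    Integrable fun ξ ↦ (1 + ‖ξ‖ ^ 2) * ‖f ξ‖ ^ 2 := by
  have h (n : ℕ) : Integrable fun ξ ↦ ‖ξ‖ ^ n * ‖f ξ‖ ^ 2 := by
    refine ((f.integrable_pow_mul volume n).mul_const (SchwartzMap.seminorm ℝ 0 0 f)).mono'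
      (by fun_prop) (Filter.Eventually.of_forall fun ξ ↦ ?_)
    rw [Real.norm_of_nonneg (by positivity), sq, ← mul_assoc]
    gcongr
    exact SchwartzMap.norm_le_seminorm ℝ f ξ
  refine ((h 0).add (h 2)).congr (Filter.Eventually.of_forall fun ξ ↦ ?_)
  simp only [Pi.add_apply]
  ring

theorem norm_rpow_le_one_add_norm_sq_rpow {r s : ℝ} (hr : 0 ≤ r) (hrs : r ≤ s) (x : Plane) :
    ‖x‖ ^ (2 * r) ≤ (1 + ‖x‖ ^ 2) ^ s := by
  calc ‖x‖ ^ (2 * r) = (‖x‖ ^ 2) ^ r := by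
        rw [Real.rpow_mul (norm_nonneg x), Real.rpow_two]
    _ ≤ (1 + ‖x‖ ^ 2) ^ r := by gcongr; linarith
    _ ≤ (1 + ‖x‖ ^ 2) ^ s :=
        Real.rpow_le_rpow_of_exponent_le (by nlinarith [sq_nonneg ‖x‖]) hrs

theorem integrable_one_add_norm_sq_rpow_mul_norm_sq (f : SchwartzMap Plane ℂ) {s : ℝ}
    (hs : s ≤ 1) : Integrable fun ξ ↦ (1 + ‖ξ‖ ^ 2) ^ s * ‖f ξ‖ ^ 2 := by
  refine (integrable_one_add_norm_sq_mul_norm_sq f).mono'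
    (Measurable.aestronglyMeasurable (by fun_prop)) (Filter.Eventually.of_forall fun ξ ↦ ?_)
  rw [Real.norm_of_nonneg (by positivity)]
  gcongr
  exact (Real.rpow_le_rpow_of_exponent_le (by nlinarith [sq_nonneg ‖ξ‖]) hs).trans_eq
    (Real.rpow_one _)

theorem integrable_norm_rpow_mul_norm_sq (f : SchwartzMap Plane ℂ) {r : ℝ}
    (hr : 0 ≤ r) (hr1 : r ≤ 1) : Integrable fun ξ ↦ ‖ξ‖ ^ (2 * r) * ‖f ξ‖ ^ 2 := by
  refine (integrable_one_add_norm_sq_rpow_mul_norm_sq f le_rfl).mono'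
    (Measurable.aestronglyMeasurable (by fun_prop)) (Filter.Eventually.of_forall fun ξ ↦ ?_)
  rw [Real.norm_of_nonneg (by positivity)]
  gcongr
  exact norm_rpow_le_one_add_norm_sq_rpow hr hr1 ξ

theorem enorm_rpow_mul_enorm_sq {r : ℝ} (hr : 0 ≤ r) (x : Plane) (z : ℂ) :
    (‖x‖ₑ ^ r * ‖z‖ₑ) ^ 2 = ENNReal.ofReal (‖x‖ ^ (2 * r) * ‖z‖ ^ 2) := by
  rw [mul_pow, ENNReal.ofReal_mul (by positivity), ENNReal.ofReal_pow (norm_nonneg z), ofReal_norm,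
    ← ENNReal.ofReal_rpow_of_nonneg (norm_nonneg x) (by positivity), ofReal_norm,
    ← ENNReal.rpow_two, ← ENNReal.rpow_mul, mul_comm r]

theorem ofReal_one_add_norm_sq_rpow_le {s : ℝ} (hs : s ≤ 1) {ξ : Plane} (hξ : ξ ≠ 0) (z : ℂ) :
    ENNReal.ofReal ((1 + ‖ξ‖ ^ 2) ^ (s - 1) * ‖z‖ ^ 2) ≤ (‖ξ‖ₑ ^ (-(1 - s)) * ‖z‖ₑ) ^ 2 := by
  have h0 : 0 < ‖ξ‖ := norm_pos_iff.2 hξ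
  rw [mul_pow, ENNReal.ofReal_mul (by positivity), ENNReal.ofReal_pow (norm_nonneg z), ofReal_norm]
  gcongr
  rw [← ofReal_norm, ENNReal.ofReal_rpow_of_pos h0, ← ENNReal.ofReal_pow (by positivity)]
  refine ENNReal.ofReal_le_ofReal ?_
  calc (1 + ‖ξ‖ ^ 2) ^ (s - 1) ≤ (‖ξ‖ ^ 2) ^ (s - 1) :=
        Real.rpow_le_rpow_of_nonpos (by positivity) (by linarith) (by linarith)
    _ = (‖ξ‖ ^ (-(1 - s))) ^ 2 := by
        rw [← Real.rpow_two, ← Real.rpow_two, ← Real.rpow_mul h0.le, ← Real.rpow_mul h0.le]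
        ring_nf

theorem lintegral_rieszKernel_weighted {a t σ : ℝ} {ξ : Plane} (hξ : ξ ≠ 0)
    (U V : Plane → ℝ≥0∞) :
    ∫⁻ η, rieszKernel a t σ ξ η * (‖ξ - η‖ₑ ^ t * U (ξ - η) * (‖η‖ₑ ^ σ * V η)) =
      ‖ξ‖ₑ ^ (-a) * ∫⁻ η, U (ξ - η) * V η := by
  rw [← lintegral_const_mul' _ _ (ENNReal.rpow_ne_top_of_ne_zero (by simpa using hξ)
    enorm_ne_top)]
  refine lintegral_congr_ae ?_
  have e (x : Plane) (hx : x ≠ 0) (r : ℝ) : ‖x‖ₑ ^ (-r) * ‖x‖ₑ ^ r = 1 := by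
    rw [← ENNReal.rpow_add _ _ (by simpa using hx) enorm_ne_top, neg_add_cancel, ENNReal.rpow_zero]
  filter_upwards [Measure.ae_ne volume (0 : Plane), Measure.ae_ne volume ξ] with η h0 h1
  calc rieszKernel a t σ ξ η * (‖ξ - η‖ₑ ^ t * U (ξ - η) * (‖η‖ₑ ^ σ * V η))
      = ‖ξ‖ₑ ^ (-a) * ((‖ξ - η‖ₑ ^ (-t) * ‖ξ - η‖ₑ ^ t) * (‖η‖ₑ ^ (-σ) * ‖η‖ₑ ^ σ) *
          (U (ξ - η) * V η)) := by
        rw [rieszKernel]; ring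
    _ = _ := by rw [e _ (sub_ne_zero.2 h1.symm), e _ h0, one_mul, one_mul]

theorem product_estimate_elliptic2 (s σ : ℝ)
    (hs : 1/2 < s) (hs1 : s ≤ 1) (hσ : 0 < σ) (hσ1 : σ < 2 * s - 1) :
    ∃ C > 0, ∀ u v : SchwartzMap Plane ℂ,
      sobNorm (s - 1) (fun x => u x * v x) ≤
        C * sobNorm s (fun x => u x) * homNorm σ (fun x => v x) := by
  obtain ⟨C, hC, h⟩ := exists_lintegral_rieszKernel_sq_le (a := 1 - s) (t := s - σ) (σ := σ)
    (by linarith) (by linarith) (by linarith) hσ.le (by linarith) (by ring)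
  refine ⟨C.toReal ^ (1 / 2 : ℝ) + 1, by positivity, fun u v ↦ ?_⟩
  set P := ∫ ξ : Plane, (1 + ‖ξ‖ ^ 2) ^ s * ‖𝓕 (fun x ↦ u x) ξ‖ ^ 2
  set Q := ∫ ξ : Plane, ‖ξ‖ ^ (2 * σ) * ‖𝓕 (fun x ↦ v x) ξ‖ ^ 2
  have hP0 : 0 ≤ P := integral_nonneg fun ξ ↦ by positivity
  have hQ0 : 0 ≤ Q := integral_nonneg fun ξ ↦ by positivity
  have hu : Measurable (𝓕 (fun x ↦ u x)) := (𝓕 u).continuous.measurable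
  have hv : Measurable (𝓕 (fun x ↦ v x)) := (𝓕 v).continuous.measurable
  have huv : Measurable (𝓕 (fun x ↦ u x * v x)) :=
    (𝓕 (SchwartzMap.pairing (ContinuousLinearMap.mul ℂ ℂ) u v)).continuous.measurable
  have hPl : ENNReal.ofReal P =
      ∫⁻ ξ : Plane, ENNReal.ofReal ((1 + ‖ξ‖ ^ 2) ^ s * ‖𝓕 (fun x ↦ u x) ξ‖ ^ 2) :=
    ofReal_integral_eq_lintegral_ofReal (integrable_one_add_norm_sq_rpow_mul_norm_sq (𝓕 u) hs1)
      (Filter.Eventually.of_forall fun ξ ↦ by positivity)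
  have hQl : ENNReal.ofReal Q =
      ∫⁻ ξ : Plane, ENNReal.ofReal (‖ξ‖ ^ (2 * σ) * ‖𝓕 (fun x ↦ v x) ξ‖ ^ 2) :=
    ofReal_integral_eq_lintegral_ofReal
      (integrable_norm_rpow_mul_norm_sq (𝓕 v) hσ.le (by linarith))
      (Filter.Eventually.of_forall fun ξ ↦ by positivity)
  have key : ∫⁻ ξ : Plane, ENNReal.ofReal
      ((1 + ‖ξ‖ ^ 2) ^ (s - 1) * ‖𝓕 (fun x ↦ u x * v x) ξ‖ ^ 2) ≤
      C * (ENNReal.ofReal P * ENNReal.ofReal Q) := by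
    calc _ ≤ ∫⁻ ξ, (∫⁻ η, rieszKernel (1 - s) (s - σ) σ ξ η *
          (‖ξ - η‖ₑ ^ (s - σ) * ‖𝓕 (fun x ↦ u x) (ξ - η)‖ₑ *
            (‖η‖ₑ ^ σ * ‖𝓕 (fun x ↦ v x) η‖ₑ))) ^ 2 := by
          refine lintegral_mono_ae ?_
          filter_upwards [Measure.ae_ne volume (0 : Plane)] with ξ hξ
          rw [lintegral_rieszKernel_weighted hξ (fun x ↦ ‖𝓕 (fun x ↦ u x) x‖ₑ)
            (fun x ↦ ‖𝓕 (fun x ↦ v x) x‖ₑ)]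
          refine (ofReal_one_add_norm_sq_rpow_le hs1 hξ _).trans ?_
          gcongr
          rw [fourier_mul_eq_integral]
          refine (enorm_integral_le_lintegral_enorm _).trans_eq ?_
          simp_rw [enorm_mul]
      _ ≤ C * ((∫⁻ x, (‖x‖ₑ ^ (s - σ) * ‖𝓕 (fun x ↦ u x) x‖ₑ) ^ 2) *
            ∫⁻ x, (‖x‖ₑ ^ σ * ‖𝓕 (fun x ↦ v x) x‖ₑ) ^ 2) :=
          h (fun x ↦ ‖x‖ₑ ^ (s - σ) * ‖𝓕 (fun x ↦ u x) x‖ₑ)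
            (fun x ↦ ‖x‖ₑ ^ σ * ‖𝓕 (fun x ↦ v x) x‖ₑ) (by fun_prop) (by fun_prop)
      _ ≤ C * (ENNReal.ofReal P * ENNReal.ofReal Q) := by
          rw [hPl, hQl]
          gcongr with x x
          · rw [enorm_rpow_mul_enorm_sq (by linarith)]
            refine ENNReal.ofReal_le_ofReal ?_
            gcongr
            exact norm_rpow_le_one_add_norm_sq_rpow (by linarith) (by linarith) x
          · exact (enorm_rpow_mul_enorm_sq hσ.le _ _).le
  have hL : ∫ ξ : Plane, (1 + ‖ξ‖ ^ 2) ^ (s - 1) * ‖𝓕 (fun x ↦ u x * v x) ξ‖ ^ 2 ≤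
      C.toReal * (P * Q) := by
    rw [integral_eq_lintegral_of_nonneg_ae (Filter.Eventually.of_forall fun ξ ↦ by positivity)
      (Measurable.aestronglyMeasurable (by fun_prop))]
    refine (ENNReal.toReal_mono (by finiteness) key).trans_eq ?_
    rw [ENNReal.toReal_mul, ENNReal.toReal_mul, ENNReal.toReal_ofReal hP0,
      ENNReal.toReal_ofReal hQ0]
  calc sobNorm (s - 1) (fun x => u x * v x) ≤ (C.toReal * (P * Q)) ^ (1 / 2 : ℝ) :=
        Real.rpow_le_rpow (integral_nonneg fun ξ ↦ by positivity) hL (by norm_num)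
    _ = C.toReal ^ (1 / 2 : ℝ) * P ^ (1 / 2 : ℝ) * Q ^ (1 / 2 : ℝ) := by
        rw [Real.mul_rpow (by positivity) (by positivity), Real.mul_rpow hP0 hQ0, mul_assoc]
    _ ≤ (C.toReal ^ (1 / 2 : ℝ) + 1) * P ^ (1 / 2 : ℝ) * Q ^ (1 / 2 : ℝ) := by
        gcongr
        linarith

end
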